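/- Suppose w₀ ∈ W satisfies ℓ(w₀·w) = ℓ(w₀) − ℓ(w) and ℓ(w·w₀) = ℓ(w₀) − ℓ(w) for all w ∈ W (w₀ is the longest element of the finite Coxeter group W), and let θ₀ : W → W be the automorphism w ↦ w₀·w·w₀. Let θ : W → W be a group automorphism mapping S onto itself, and let 𝒦 ⊆ W be a quasiparabolic θ-twisted conjugacy class. Then the set 𝒦·w₀ = {x·w₀ : x ∈ 𝒦} is a (θ ∘ θ₀)-twisted conjugacy class of W, and it is quasiparabolic (with respect to the (θ ∘ θ₀)-twisted conjugation action and the height function ht = ℓ/2). -/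

import Mathlib

noncomputable section

variable {B W : Type*} [Group W] {M : CoxeterMatrix B}

/-- The `θ`-twisted conjugation action of `W` on itself: `w • x = w·x·θ(w)⁻¹`. -/
def twConj (θ : W ≃* W) (w x : W) : W := w * x * (θ w)⁻¹

/-- The height function `ht = ℓ/2` on `W`. -/
def htL (cs : CoxeterSystem M W) (x : W) : ℚ := (cs.length x : ℚ) / 2

/-- `𝒦` is a `θ`-twisted conjugacy class, i.e. an orbit of the twisted conjugation action. -/
def IsTwClass (θ : W ≃* W) (𝒦 : Set W) : Prop :=
  ∃ x₀ : W, 𝒦 = Set.range fun w => twConj θ w x₀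

/-- The `θ`-twisted conjugacy class `𝒦` is quasiparabolic with respect to the height
function `ht = ℓ/2`: (QP1) and (QP2) hold. -/
def IsQPClass (cs : CoxeterSystem M W) (θ : W ≃* W) (𝒦 : Set W) : Prop :=
  (∀ r : W, cs.IsReflection r → ∀ x ∈ 𝒦,
      htL cs (twConj θ r x) = htL cs x → twConj θ r x = x) ∧
  (∀ r : W, cs.IsReflection r → ∀ x ∈ 𝒦, ∀ i : B,
      htL cs x < htL cs (twConj θ r x) →
      htL cs (twConj θ (cs.simple i) (twConj θ r x)) < htL cs (twConj θ (cs.simple i) x) →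
      twConj θ r x = twConj θ (cs.simple i) x)

/-- `x` is a `W`-minimal element: `ℓ(s·x·θ(s)⁻¹) ≥ ℓ(x)` for all simple reflections `s`. -/
def TwMin (cs : CoxeterSystem M W) (θ : W ≃* W) (x : W) : Prop :=
  ∀ i : B, cs.length x ≤ cs.length (twConj θ (cs.simple i) x)

/-- The automorphism `θ` maps the set `S` of simple reflections onto itself. -/
def SimpleOnto (cs : CoxeterSystem M W) (θ : W ≃* W) : Prop :=
  ⇑θ '' Set.range cs.simple = Set.range cs.simple

theorem CoxeterSystem.length_map_le (cs : CoxeterSystem M W) {θ : W ≃* W}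
    (hθ : SimpleOnto cs θ) (w : W) : cs.length (θ w) ≤ cs.length w := by
  have hf (i : B) : ∃ j, cs.simple j = θ (cs.simple i) := by
    have : θ (cs.simple i) ∈ Set.range cs.simple := hθ ▸ ⟨_, ⟨i, rfl⟩, rfl⟩
    exact this
  choose f hf using hf
  have map_wordProd (ω : List B) : θ (cs.wordProd ω) = cs.wordProd (ω.map f) := by
    induction ω with
    | nil => simp
    | cons i ω ih => simp [cs.wordProd_cons, hf, ih]
  obtain ⟨ω, hω, rfl⟩ := cs.exists_isReduced w
  rw [map_wordProd, hω.eq]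
  simpa using cs.length_wordProd_le (ω.map f)

theorem twConj_mul (θ : W ≃* W) (v w x : W) :
    twConj θ (v * w) x = twConj θ v (twConj θ w x) := by
  simp [twConj, mul_assoc]

theorem twConj_twConj_of_mul_self {θ : W ≃* W} {r : W} (hr : r * r = 1) (x : W) :
    twConj θ r (twConj θ r x) = x := by
  rw [← twConj_mul, hr]
  simp [twConj]

/-- Let `w₀` be the longest element of the finite Coxeter group `W`, let
`θ₀ : w ↦ w₀·w·w₀`, and let `𝒦` be a quasiparabolic `θ`-twisted conjugacy class. Then
`𝒦·w₀` is a `(θ ∘ θ₀)`-twisted conjugacy class and it is quasiparabolic. -/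
theorem stmt19 (cs : CoxeterSystem M W) (w₀ : W)
    (hw₀ : ∀ w : W, (cs.length (w₀ * w) : ℤ) = (cs.length w₀ : ℤ) - cs.length w ∧
      (cs.length (w * w₀) : ℤ) = (cs.length w₀ : ℤ) - cs.length w)
    (θ : W ≃* W) (hθS : SimpleOnto cs θ)
    (𝒦 : Set W) (hK : IsTwClass θ 𝒦) (hqp : IsQPClass cs θ 𝒦) :
    ∀ θ₀ : W ≃* W, (∀ w : W, θ₀ w = w₀ * w * w₀) →
      IsTwClass (θ₀.trans θ) ((fun x => x * w₀) '' 𝒦) ∧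
      IsQPClass cs (θ₀.trans θ) ((fun x => x * w₀) '' 𝒦) := by
  intro θ₀ hθ₀
  have eq_of_length {u : W} (hu : cs.length w₀ ≤ cs.length u) : w₀ * u = 1 := by
    rw [← cs.length_eq_zero_iff]
    have := (hw₀ u).1
    omega
  have hsq : w₀ * w₀ = 1 := eq_of_length le_rfl
  have hfix : θ w₀ = w₀ := by
    have h : w₀ * θ.symm w₀ = 1 :=
      eq_of_length (by simpa using cs.length_map_le hθS (θ.symm w₀))
    rw [← θ.eq_symm_apply]
    exact mul_left_cancel (hsq.trans h.symm)
  have hinv : w₀⁻¹ = w₀ := inv_eq_of_mul_eq_one_left hsq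
  have hact (w x : W) : twConj (θ₀.trans θ) w (x * w₀) = twConj θ w x * w₀ := by
    have hcancel (y : W) : w₀ * (w₀ * y) = y := by rw [← mul_assoc, hsq, one_mul]
    simp only [twConj, MulEquiv.trans_apply, hθ₀, map_mul, hfix, mul_inv_rev, hinv, mul_assoc,
      hcancel]
  have hht (x : W) : htL cs (x * w₀) = htL cs w₀ - htL cs x := by
    have h : (cs.length (x * w₀) : ℚ) = cs.length w₀ - cs.length x := by
      exact_mod_cast (hw₀ x).2
    simp only [htL, h]
    ring
  refine ⟨?_, ?_, ?_⟩
  · obtain ⟨x₀, rfl⟩ := hK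
    refine ⟨x₀ * w₀, ?_⟩
    rw [← Set.range_comp]
    simp only [Function.comp_def, hact]
  · rintro r hr _ ⟨x, hx, rfl⟩ h
    simp only [hact, hht] at h ⊢
    rw [hqp.1 r hr x hx (by linarith)]
  · rintro r hr _ ⟨x, hx, rfl⟩ i h₁ h₂
    simp only [hact, hht] at h₁ h₂ ⊢
    have hrx := twConj_twConj_of_mul_self (θ := θ) hr.mul_self x
    have hy : twConj θ r x ∈ 𝒦 := by
      obtain ⟨x₀, rfl⟩ := hK
      obtain ⟨v, rfl⟩ := hx
      exact ⟨r * v, twConj_mul θ r v x₀⟩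
    have h := hqp.2 r hr _ hy i (by rw [hrx]; linarith) (by rw [hrx]; linarith)
    rw [hrx] at h
    rw [congrArg (twConj θ (cs.simple i)) h,
      twConj_twConj_of_mul_self (cs.simple_mul_simple_self i)]

end
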